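/- arXiv:2103.09119 — 2 statements merged into one kernel-verified Lean document; each statement's English description precedes it below -/
import Mathlib

section
/- Let q be an odd prime power, F a finite field with q elements, a ∈ F with a ≠ 0, and n an even nonnegative integer. Then the residue sum S_q(D_n(x,a)) is an element of the set {0, a^(n/2), −a^(n/2), 2·a^(n/2), −2·a^(n/2)}. -/
open Polynomial

theorem Polynomial.eval_add_dickson_one {R : Type*} [CommRing R] (u v : R) (n : ℕ) :
    eval (u + v) (dickson 1 (u * v) n) = u ^ n + v ^ n := by
  induction n using Nat.twoStepInduction with
  | zero => simp [dickson_zero]; norm_num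
  | one => simp
  | more n h₀ h₁ =>
    rw [dickson_add_two, eval_sub, eval_mul, eval_mul, eval_X, eval_C, h₀, h₁]
    ring

theorem add_inv_eq_add_inv_iff {K : Type*} [Field K] {v w : K} (hv : v ≠ 0) (hw : w ≠ 0) :
    v + v⁻¹ = w + w⁻¹ ↔ v = w ∨ v = w⁻¹ := by
  constructor
  · intro h
    have : (v - w) * (v * w - 1) = 0 := by
      field_simp at h
      linear_combination h
    rcases mul_eq_zero.1 this with h | h
    · exact .inl (sub_eq_zero.1 h)
    · exact .inr (eq_inv_of_mul_eq_one_left (sub_eq_zero.1 h))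
  · rintro (rfl | rfl)
    · rfl
    · rw [inv_inv, add_comm]

theorem sum_image_add_inv {K : Type*} [Field K] [DecidableEq K] (s : Finset K)
    (h0 : ∀ w ∈ s, w ≠ 0) (hinv : ∀ w ∈ s, w⁻¹ ∈ s) :
    ∑ y ∈ s.image (fun w => w + w⁻¹), y = ∑ w ∈ s, (w + if w ^ 2 = 1 then w else 0) := by
  refine Finset.sum_image' _ fun w hw => ?_
  have hfilter : s.filter (fun j => j + j⁻¹ = w + w⁻¹) = {w, w⁻¹} := by
    ext j
    simp only [Finset.mem_filter, Finset.mem_insert, Finset.mem_singleton]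
    constructor
    · rintro ⟨hj, h⟩
      exact (add_inv_eq_add_inv_iff (h0 j hj) (h0 w hw)).1 h
    · intro h
      have hj : j ∈ s := by
        rcases h with rfl | rfl
        exacts [hw, hinv w hw]
      exact ⟨hj, (add_inv_eq_add_inv_iff (h0 j hj) (h0 w hw)).2 h⟩
  rw [hfilter]
  have hw0 := h0 w hw
  by_cases h : w ^ 2 = 1
  · have hwi : w⁻¹ = w := inv_eq_of_mul_eq_one_left (by rw [← sq, h])
    rw [hwi, Finset.pair_eq_singleton, Finset.sum_singleton, if_pos h]
  · have hne : w ≠ w⁻¹ := fun h' => h (by rw [sq]; nth_rw 2 [h']; exact mul_inv_cancel₀ hw0)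
    rw [Finset.sum_pair hne]
    simp [h]

theorem sum_ite_sq_eq_one {K : Type*} [Field K] [DecidableEq K] (h2 : (1 : K) ≠ -1)
    (s : Finset K) :
    ∑ w ∈ s, (if w ^ 2 = 1 then w else 0) =
      (if 1 ∈ s then 1 else 0) - if -1 ∈ s then 1 else 0 := by
  have h (w : K) : (if w ^ 2 = 1 then w else 0) =
      (if w = 1 then 1 else 0) - if w = -1 then 1 else 0 := by
    by_cases h₁ : w = 1
    · simp [h₁, h2]
    · by_cases h₂ : w = -1
      · simp [h₂, h2.symm]
      · simp [h₁, h₂]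
  simp_rw [h, Finset.sum_sub_distrib]
  simp

theorem sum_image_torsor {K : Type*} [Field K] [DecidableEq K] (U : Finset K) {a : K}
    (ha : a ≠ 0) (m : ℕ) (h0 : ∀ u ∈ U, u ≠ 0)
    (hmul : ∀ u ∈ U, ∀ v ∈ U, ∀ w ∈ U, u * v / w ∈ U) (hinv : ∀ u ∈ U, a / u ∈ U) :
    (∑ w ∈ U.image (fun u => (u ^ 2 / a) ^ m), w) = 0 ∨
      U.image (fun u => (u ^ 2 / a) ^ m) = {1} ∨ U.image (fun u => (u ^ 2 / a) ^ m) = {-1} := by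
  set A := U.image (fun u => (u ^ 2 / a) ^ m) with hA
  rcases U.eq_empty_or_nonempty with rfl | ⟨u₀, hu₀⟩
  · simp [hA]
  by_cases h : ∃ u ∈ U, ∃ v ∈ U, (u / v) ^ (2 * m) ≠ 1
  · obtain ⟨u, hu, v, hv, huv⟩ := h
    left
    have hu0 := h0 u hu
    have hv0 := h0 v hv
    have hc : (u / v) ^ (2 * m) ≠ 0 := pow_ne_zero _ (div_ne_zero hu0 hv0)
    have himage : A.image (fun w => (u / v) ^ (2 * m) * w) = A := by
      refine Finset.eq_of_subset_of_card_le ?_ ?_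
      · intro w hw
        simp only [hA, Finset.mem_image, exists_exists_and_eq_and] at hw ⊢
        obtain ⟨x, hx, rfl⟩ := hw
        refine ⟨_, hmul u hu x hx v hv, ?_⟩
        rw [pow_mul, ← mul_pow]
        congr 1
        field_simp
      · rw [Finset.card_image_of_injective _ (mul_right_injective₀ hc)]
    have hsum : (u / v) ^ (2 * m) * ∑ w ∈ A, w = ∑ w ∈ A, w := by
      conv_rhs => rw [← himage, Finset.sum_image (mul_right_injective₀ hc).injOn]
      rw [Finset.mul_sum]
    have : ((u / v) ^ (2 * m) - 1) * ∑ w ∈ A, w = 0 := by linear_combination hsum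
    exact (mul_eq_zero.1 this).resolve_left (sub_ne_zero.2 huv)
  · push Not at h
    right
    have hconst : ∀ u ∈ U, (u ^ 2 / a) ^ m = (u₀ ^ 2 / a) ^ m := by
      intro u hu
      have := h u hu u₀ hu₀
      have hu₀0 := h0 u₀ hu₀
      rw [pow_mul, div_pow, div_pow, div_eq_one_iff_eq (pow_ne_zero _ (pow_ne_zero _ hu₀0))] at this
      rw [div_pow, div_pow, this]
    have hsingle : A = {(u₀ ^ 2 / a) ^ m} := by
      rw [hA, Finset.image_congr (g := fun _ => (u₀ ^ 2 / a) ^ m) hconst]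
      exact Finset.image_const ⟨u₀, hu₀⟩ _
    have hsq : ((u₀ ^ 2 / a) ^ m) ^ 2 = 1 := by
      have hu₀0 := h0 u₀ hu₀
      have h' := hconst _ (hinv u₀ hu₀)
      rw [sq]
      nth_rw 1 [← h']
      rw [← mul_pow, show (a / u₀) ^ 2 / a * (u₀ ^ 2 / a) = 1 by field_simp, one_pow]
    rw [hsingle]
    rcases mul_self_eq_one_iff.1 ((sq _).symm.trans hsq) with h | h <;> simp [h]

theorem FiniteField.exists_algebraMap_eq_of_pow_card_eq {F K : Type*} [Field F] [Fintype F]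
    [Field K] [Algebra F K] {z : K} (hz : z ^ Fintype.card F = z) :
    ∃ x : F, algebraMap F K x = z := by
  classical
  have hq : 1 < Fintype.card F := Fintype.one_lt_card
  have hne : (X ^ Fintype.card F - X : K[X]) ≠ 0 := FiniteField.X_pow_card_sub_X_ne_zero K hq
  have himage : Finset.univ.image (algebraMap F K) =
      (X ^ Fintype.card F - X : K[X]).roots.toFinset := by
    refine Finset.eq_of_subset_of_card_le ?_ ?_
    · intro y hy
      obtain ⟨x, -, rfl⟩ := Finset.mem_image.1 hy
      simp [hne, ← map_pow, FiniteField.pow_card]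
    · rw [Finset.card_image_of_injective _ (algebraMap F K).injective, Finset.card_univ]
      refine (Multiset.toFinset_card_le _).trans ((card_roots' _).trans_eq ?_)
      exact FiniteField.X_pow_card_sub_X_natDegree_eq K hq
  have hmem : z ∈ Finset.univ.image (algebraMap F K) := by
    rw [himage]
    simp [hne, hz]
  obtain ⟨x, -, hx⟩ := Finset.mem_image.1 hmem
  exact ⟨x, hx⟩

theorem sum_image_union_add_inv_mem {K : Type*} [Field K] [DecidableEq K] (h2 : (1 : K) ≠ -1)
    (A B : Finset K) (hA0 : ∀ w ∈ A, w ≠ 0) (hB0 : ∀ w ∈ B, w ≠ 0)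
    (hAinv : ∀ w ∈ A, w⁻¹ ∈ A) (hBinv : ∀ w ∈ B, w⁻¹ ∈ B)
    (hAB : ∀ w ∈ A, w ∈ B → w ^ 2 = 1)
    (hA : ∑ w ∈ A, w = 0 ∨ A = {1} ∨ A = {-1}) (hB : ∑ w ∈ B, w = 0 ∨ B = {1} ∨ B = {-1}) :
    ∑ y ∈ (A ∪ B).image (fun w => w + w⁻¹), y ∈ ({0, 1, -1, 2, -2} : Set K) := by
  rw [sum_image_add_inv]
  · have hunion := Finset.sum_union_inter (s₁ := A) (s₂ := B)
      (f := fun w : K => w + if w ^ 2 = 1 then w else 0)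
    have hinter : ∑ w ∈ A ∩ B, w = ∑ w ∈ A ∩ B, if w ^ 2 = 1 then w else 0 :=
      Finset.sum_congr rfl fun w hw => by
        rw [if_pos (hAB w (Finset.mem_inter.1 hw).1 (Finset.mem_inter.1 hw).2)]
    rw [Finset.sum_add_distrib (s := A ∩ B), Finset.sum_add_distrib (s := A),
      Finset.sum_add_distrib (s := B), hinter, sum_ite_sq_eq_one h2, sum_ite_sq_eq_one h2,
      sum_ite_sq_eq_one h2] at hunion
    rw [eq_sub_of_add_eq hunion]
    have hsum (s : Finset K) (hs : ∑ w ∈ s, w = 0 ∨ s = {1} ∨ s = {-1}) :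
        ∑ w ∈ s, w = 0 ∨ (∑ w ∈ s, w = 1 ∧ 1 ∈ s ∧ -1 ∉ s) ∨
          (∑ w ∈ s, w = -1 ∧ 1 ∉ s ∧ -1 ∈ s) := by
      rcases hs with hs | rfl | rfl
      · exact .inl hs
      · simp [h2.symm]
      · simp [h2]
    simp only [Finset.mem_inter, Set.mem_insert_iff, Set.mem_singleton_iff]
    clear hunion hinter
    rcases hsum A hA with hA | ⟨hA, hA₁, hA₂⟩ | ⟨hA, hA₁, hA₂⟩ <;>
      rcases hsum B hB with hB | ⟨hB, hB₁, hB₂⟩ | ⟨hB, hB₁, hB₂⟩ <;> rw [hA, hB] <;>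
      by_cases hA₁ : 1 ∈ A <;> by_cases hA₂ : -1 ∈ A <;>
      by_cases hB₁ : 1 ∈ B <;> by_cases hB₂ : -1 ∈ B <;>
      first | contradiction | (simp only [*, and_true, and_false, if_true, if_false]; norm_num)
  · intro w hw
    exact (Finset.mem_union.1 hw).elim (hA0 w) (hB0 w)
  · intro w hw
    exact Finset.mem_union.2 ((Finset.mem_union.1 hw).imp (hAinv w) (hBinv w))

theorem inv_mem_image_of_div_mem {K : Type*} [Field K] [DecidableEq K] {U : Finset K} {a : K}
    (ha : a ≠ 0) (m : ℕ) (h0 : ∀ u ∈ U, u ≠ 0) (hinv : ∀ u ∈ U, a / u ∈ U) :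
    ∀ w ∈ U.image (fun u => (u ^ 2 / a) ^ m), w⁻¹ ∈ U.image (fun u => (u ^ 2 / a) ^ m) := by
  intro w hw
  obtain ⟨u, hu, rfl⟩ := Finset.mem_image.1 hw
  have := h0 u hu
  refine Finset.mem_image.2 ⟨a / u, hinv u hu, ?_⟩
  rw [← inv_pow]
  congr 1
  field_simp

theorem Polynomial.eval_dickson_one_two_mul {K : Type*} [Field K] {u a : K} (hu : u ≠ 0)
    (ha : a ≠ 0) (m : ℕ) :
    eval (u + a / u) (dickson 1 a (2 * m)) =
      a ^ m * ((u ^ 2 / a) ^ m + ((u ^ 2 / a) ^ m)⁻¹) := by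
  have h := eval_add_dickson_one u (a / u) (2 * m)
  rw [mul_div_cancel₀ a hu] at h
  rw [h, pow_mul, pow_mul, ← inv_pow, mul_add, ← mul_pow, ← mul_pow]
  congr 2 <;> field_simp

theorem FiniteField.image_eval_dickson_one {F K : Type*} [Field F] [Fintype F] [Field K]
    [IsAlgClosed K] [Algebra F K] [DecidableEq F] [DecidableEq K] {a : F} (ha : a ≠ 0) (m : ℕ)
    (U : Finset K) (hU : ∀ u, u ∈ U ↔ u ≠ 0 ∧ (u ^ Fintype.card F = u ∨
      u ^ Fintype.card F = algebraMap F K a / u)) :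
    ((Finset.univ.image fun x : F => eval x (dickson 1 a (2 * m))).image (algebraMap F K)) =
      ((U.image fun u => (u ^ 2 / algebraMap F K a) ^ m).image fun w => w + w⁻¹).image
        (algebraMap F K a ^ m * ·) := by
  have hK : algebraMap F K a ≠ 0 := by simpa using ha
  have heval (x : F) : algebraMap F K (eval x (dickson 1 a (2 * m))) =
      eval (algebraMap F K x) (dickson 1 (algebraMap F K a) (2 * m)) := by
    rw [← map_dickson, eval_map_algebraMap, aeval_algebraMap_apply, coe_aeval_eq_eval]
  obtain ⟨p, _⟩ := CharP.exists F
  obtain ⟨k, hprime, hcard⟩ := FiniteField.card F p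
  have := Fact.mk hprime
  have : CharP K p := charP_of_injective_algebraMap (algebraMap F K).injective p
  have hadd (x y : K) : (x + y) ^ Fintype.card F = x ^ Fintype.card F + y ^ Fintype.card F := by
    rw [hcard, add_pow_char_pow]
  have haq : algebraMap F K a ^ Fintype.card F = algebraMap F K a := by
    rw [← map_pow, FiniteField.pow_card]
  ext z
  simp only [Finset.mem_image, Finset.mem_univ, true_and, exists_exists_eq_and,
    exists_exists_and_eq_and]
  constructor
  · rintro ⟨x, rfl⟩
    obtain ⟨u, hu⟩ := IsAlgClosed.exists_root
      (X ^ 2 - C (algebraMap F K x) * X + C (algebraMap F K a)) (by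
        have hdeg : (X ^ 2 - C (algebraMap F K x) * X + C (algebraMap F K a)).degree = 2 := by
          compute_degree!
        rw [hdeg]
        exact two_ne_zero)
    have hu : u ^ 2 - algebraMap F K x * u + algebraMap F K a = 0 := by simpa [IsRoot] using hu
    have hu0 : u ≠ 0 := by
      rintro rfl
      exact hK (by simpa using hu)
    have hx : algebraMap F K x = u + algebraMap F K a / u := by
      field_simp
      linear_combination -hu
    refine ⟨u, (hU u).2 ⟨hu0, ?_⟩, ?_⟩
    · have hxq : algebraMap F K x ^ Fintype.card F = algebraMap F K x := by
        rw [← map_pow, FiniteField.pow_card]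
      rw [hx, hadd, div_pow, haq] at hxq
      have huq : u ^ Fintype.card F ≠ 0 := pow_ne_zero _ hu0
      have : (u ^ Fintype.card F - u) * (u ^ Fintype.card F * u - algebraMap F K a) = 0 := by
        field_simp at hxq
        linear_combination hxq
      rcases mul_eq_zero.1 this with h | h
      · exact .inl (sub_eq_zero.1 h)
      · exact .inr (eq_div_of_mul_eq hu0 (sub_eq_zero.1 h))
    · rw [heval, hx, eval_dickson_one_two_mul hu0 hK]
  · rintro ⟨u, hu, rfl⟩
    obtain ⟨hu0, hu⟩ := (hU u).1 hu
    obtain ⟨x, hx⟩ := exists_algebraMap_eq_of_pow_card_eq (F := F)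
      (z := u + algebraMap F K a / u) (by
        rw [hadd, div_pow, haq]
        rcases hu with hu | hu
        · rw [hu]
        · rw [hu, div_div_cancel₀ hK, add_comm])
    exact ⟨x, by rw [heval, hx, eval_dickson_one_two_mul hu0 hK]⟩

theorem FiniteField.exists_algebraMap_sum_image_dickson_one {F K : Type*} [Field F] [Fintype F]
    [Field K] [IsAlgClosed K] [Algebra F K] [DecidableEq F] (h2 : (1 : K) ≠ -1) {a : F}
    (ha : a ≠ 0) (m : ℕ) :
    ∃ s ∈ ({0, 1, -1, 2, -2} : Set K), algebraMap F K
      (∑ y ∈ Finset.univ.image fun x : F => eval x (dickson 1 a (2 * m)), y) =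
        algebraMap F K a ^ m * s := by
  classical
  set q := Fintype.card F
  have hq1 : 1 < q := Fintype.one_lt_card
  have himage := image_eval_dickson_one (K := K) ha m
  have hb : algebraMap F K a ≠ 0 := by simpa using ha
  have hbq : algebraMap F K a ^ q = algebraMap F K a := by rw [← map_pow, FiniteField.pow_card]
  set b := algebraMap F K a
  let U : Finset K := (nthRoots (q - 1) 1).toFinset
  let V : Finset K := (nthRoots (q + 1) (b)).toFinset
  have hU0 : ∀ u ∈ U, u ≠ 0 := by
    rintro _ hu rfl
    simp [U, mem_nthRoots (Nat.sub_pos_of_lt hq1), (Nat.sub_pos_of_lt hq1).ne'] at hu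
  have hV0 : ∀ u ∈ V, u ≠ 0 := by
    rintro _ hu rfl
    simp [V, mem_nthRoots q.succ_pos] at hu
    exact hb hu.symm
  have hU (u : K) : u ∈ U ↔ u ≠ 0 ∧ u ^ q = u := by
    by_cases hu : u = 0
    · simpa [hu] using fun h => hU0 0 h rfl
    · simp only [U, Multiset.mem_toFinset, mem_nthRoots (Nat.sub_pos_of_lt hq1), ne_eq, hu,
        not_false_eq_true, true_and]
      rw [← mul_left_inj' hu, one_mul, pow_sub_one_mul (by omega)]
  have hV (u : K) : u ∈ V ↔ u ≠ 0 ∧ u ^ q = b / u := by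
    by_cases hu : u = 0
    · simpa [hu] using fun h => hV0 0 h rfl
    · simp only [V, Multiset.mem_toFinset, mem_nthRoots q.succ_pos, ne_eq, hu,
        not_false_eq_true, true_and]
      rw [pow_succ, eq_div_iff hu]
  have hUmul : ∀ u ∈ U, ∀ v ∈ U, ∀ w ∈ U, u * v / w ∈ U := by
    simp only [hU]
    rintro u ⟨hu, hu'⟩ v ⟨hv, hv'⟩ w ⟨hw, hw'⟩
    exact ⟨div_ne_zero (mul_ne_zero hu hv) hw, by rw [div_pow, mul_pow, hu', hv', hw']⟩
  have hVmul : ∀ u ∈ V, ∀ v ∈ V, ∀ w ∈ V, u * v / w ∈ V := by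
    simp only [hV]
    rintro u ⟨hu, hu'⟩ v ⟨hv, hv'⟩ w ⟨hw, hw'⟩
    refine ⟨div_ne_zero (mul_ne_zero hu hv) hw, ?_⟩
    rw [div_pow, mul_pow, hu', hv', hw']
    field_simp
  have hUinv : ∀ u ∈ U, b / u ∈ U := by
    simp only [hU]
    rintro u ⟨hu, hu'⟩
    exact ⟨div_ne_zero hb hu, by rw [div_pow, hu', hbq]⟩
  have hVinv : ∀ u ∈ V, b / u ∈ V := by
    simp only [hV]
    rintro u ⟨hu, hu'⟩
    exact ⟨div_ne_zero hb hu, by rw [div_pow, hu', hbq]⟩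
  let g : K → K := fun u => (u ^ 2 / b) ^ m
  have hg0 (W : Finset K) (hW : ∀ u ∈ W, u ≠ 0) : ∀ w ∈ W.image g, w ≠ 0 := by
    intro w hw
    obtain ⟨u, hu, rfl⟩ := Finset.mem_image.1 hw
    exact pow_ne_zero _ (div_ne_zero (pow_ne_zero _ (hW u hu)) hb)
  have hinter : ∀ w ∈ U.image g, w ∈ V.image g → w ^ 2 = 1 := by
    intro w hwU hwV
    have hwq : w ^ q = w := by
      obtain ⟨u, hu, rfl⟩ := Finset.mem_image.1 hwU
      simp only [g]
      rw [pow_right_comm, div_pow, pow_right_comm, ((hU u).1 hu).2, hbq]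
    obtain ⟨u, hu, rfl⟩ := Finset.mem_image.1 hwV
    have hu0 := hV0 u hu
    rw [sq]
    nth_rw 1 [← hwq]
    simp only [g]
    rw [pow_right_comm, div_pow, pow_right_comm, ((hV u).1 hu).2, hbq, ← mul_pow,
      show (b / u) ^ 2 / b * (u ^ 2 / b) = 1 by field_simp, one_pow]
  have hmem := sum_image_union_add_inv_mem h2 (U.image g) (V.image g) (hg0 U hU0) (hg0 V hV0)
    (inv_mem_image_of_div_mem hb m hU0 hUinv) (inv_mem_image_of_div_mem hb m hV0 hVinv) hinter
    (sum_image_torsor U hb m hU0 hUmul hUinv) (sum_image_torsor V hb m hV0 hVmul hVinv)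
  rw [← Finset.image_union] at hmem
  have hsum := congrArg (fun s : Finset K => ∑ y ∈ s, y) <| himage (U ∪ V) fun u => by
    rw [Finset.mem_union, hU, hV, ← and_or_left]
  beta_reduce at hsum
  rw [Finset.sum_image (algebraMap F K).injective.injOn, ← map_sum,
    Finset.sum_image (mul_right_injective₀ (pow_ne_zero m hb)).injOn, ← Finset.mul_sum] at hsum
  exact ⟨_, hmem, hsum⟩

/-- Corollary: the residue sum of a Dickson polynomial lies in `{0, ±a^(n/2), ±2a^(n/2)}`. -/
theorem dickson_residue_sum_mem {F : Type*} [Field F] [Fintype F] [DecidableEq F]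
    {q : ℕ} (hF : Fintype.card F = q) (hq : Odd q)
    (a : F) (ha : a ≠ 0) (n : ℕ) (hn : Even n) :
    (∑ y ∈ Finset.image (fun x : F => Polynomial.eval x (Polynomial.dickson 1 a n))
        Finset.univ, y) ∈
      ({0, a ^ (n / 2), -(a ^ (n / 2)), 2 * a ^ (n / 2), -(2 * a ^ (n / 2))} : Set F) := by
  obtain ⟨m, rfl⟩ := hn.two_dvd
  rw [Nat.mul_div_cancel_left m two_pos]
  have hφ : Function.Injective (algebraMap F (AlgebraicClosure F)) := (algebraMap F _).injective
  have h2 : (1 : AlgebraicClosure F) ≠ -1 := by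
    have h2F : (-1 : F) ≠ 1 := by
      refine Ring.neg_one_ne_one_of_char_ne_two fun h => ?_
      have := FiniteField.even_card_of_char_two h
      rw [Nat.odd_iff] at hq
      omega
    intro h
    exact h2F (hφ (by simpa using h.symm))
  obtain ⟨s, hs, hsum⟩ := FiniteField.exists_algebraMap_sum_image_dickson_one h2 ha m
  simp only [Set.mem_insert_iff, Set.mem_singleton_iff] at hs ⊢
  simp only [← hφ.eq_iff, hsum, map_zero, map_neg, map_mul, map_pow, map_ofNat]
  rcases hs with rfl | rfl | rfl | rfl | rfl
  · simp
  · simp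
  · simp
  · exact .inr (.inr (.inr (.inl (mul_comm _ _))))
  · exact .inr (.inr (.inr (.inr (by ring))))
end

section
/- Let q be an odd prime power with q > 3, F a finite field with q elements, a ∈ F a nonsquare (in particular a ≠ 0), and n an even natural number. Let r be the 2-adic valuation of q²−1. Then the intersection of the image of the hyperbolic set H_q(a) under D_n(·,a) with the image of the elliptic set E_q(a) under D_n(·,a) equals {2·a^(n/2)} if 2^r divides n, and is empty otherwise. -/
open Polynomial

theorem dickson_one_eval_add {R : Type*} [CommRing R] {a y w : R} (h : y * w = a) :
    ∀ n : ℕ, (dickson 1 a n).eval (y + w) = y ^ n + w ^ n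
  | 0 => by simp only [pow_zero, dickson_zero]; norm_num
  | 1 => by simp only [eval_X, dickson_one, pow_one]
  | n + 2 => by
    simp only [dickson_add_two, eval_sub, eval_mul, eval_X, eval_C, dickson_one_eval_add h n,
      dickson_one_eval_add h (n + 1)]
    rw [← h]
    ring

theorem two_pow_succ_dvd_of_pow_eq_neg_one {A : Type*} [Ring A] {v : A} (h1 : (-1 : A) ≠ 1)
    {k m s : ℕ} (hk : v ^ k = -1) (hm : v ^ m = 1) (hs : 2 ^ s ∣ k) : 2 ^ (s + 1) ∣ m := by
  have hd : orderOf v ∣ 2 * k :=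
    orderOf_dvd_of_pow_eq_one (by rw [mul_comm, pow_mul, hk, neg_one_sq])
  refine dvd_trans ?_ (orderOf_dvd_of_pow_eq_one hm)
  obtain ⟨e, he⟩ := hd
  have hodd : Odd e := by
    rw [← Nat.not_even_iff_odd]
    rintro ⟨f, rfl⟩
    have : orderOf v ∣ k := ⟨f, by linarith⟩
    exact h1 (hk.symm.trans (orderOf_dvd_iff_pow_eq_one.mp this))
  have h2 : 2 ^ (s + 1) ∣ orderOf v * e := by
    rw [← he, pow_succ']
    exact mul_dvd_mul_left 2 hs
  exact (Nat.Coprime.pow_left _ (Nat.coprime_two_left.mpr hodd)).dvd_of_dvd_mul_right h2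

theorem even_iff_even_of_pow_eq_neg_one {A : Type*} [Ring A] {v : A} (h1 : (-1 : A) ≠ 1)
    {k m : ℕ} (hk : v ^ k = -1) (hm : v ^ m = -1) : Even k ↔ Even m := by
  have h : (-1 : A) ^ m = (-1) ^ k := by rw [← hk, ← pow_mul, mul_comm, pow_mul, hm, hk]
  rcases Nat.even_or_odd k with hk' | hk' <;> rcases Nat.even_or_odd m with hm' | hm'
  · simp [hk', hm']
  · rw [hk'.neg_one_pow, hm'.neg_one_pow] at h
    exact absurd h h1
  · rw [hk'.neg_one_pow, hm'.neg_one_pow] at h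
    exact absurd h.symm h1
  · simp [Nat.not_even_iff_odd.mpr hk', Nat.not_even_iff_odd.mpr hm']

theorem exists_algebraMap_eq_of_pow_card {F A : Type*} [Field F] [Fintype F] [Field A]
    [Algebra F A] {z : A} (hz : z ^ Fintype.card F = z) : ∃ x : F, algebraMap F A x = z := by
  have h0 := FiniteField.X_pow_card_sub_X_ne_zero F (Fintype.one_lt_card (α := F))
  have hs : (X ^ Fintype.card F - X : F[X]).Splits := by
    rw [splits_iff_card_roots, FiniteField.roots_X_pow_card_sub_X,
      FiniteField.X_pow_card_sub_X_natDegree_eq F Fintype.one_lt_card]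
    rfl
  exact hs.mem_range_of_isRoot (f := X ^ Fintype.card F - X) h0 (i := algebraMap F A)
    (by simp [hz])

theorem sq_sub_four_mul_isSquare_iff {F : Type*} [Field F] (h2 : (2 : F) ≠ 0) {a : F}
    (ha : ¬ IsSquare a) (x : F) :
    (x ^ 2 - 4 * a ≠ 0 ∧ IsSquare (x ^ 2 - 4 * a)) ↔ ∃ y w : F, y * w = a ∧ y + w = x := by
  constructor
  · rintro ⟨-, s, hs⟩
    refine ⟨(x + s) / 2, (x - s) / 2, ?_, by field_simp; ring⟩
    field_simp
    linear_combination hs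
  · rintro ⟨y, w, rfl, rfl⟩
    refine ⟨fun h => ha ⟨y, ?_⟩, y - w, by ring⟩
    have : y - w = 0 := by
      rw [← sq_eq_zero_iff]
      linear_combination h
    linear_combination -y * this

theorem not_isSquare_sq_sub_four_mul_iff {F A : Type*} [Field F] [Fintype F] [Field A]
    [Algebra F A] [IsAlgClosed A] (h2 : (2 : F) ≠ 0) {a : F} (ha : ¬ IsSquare a) (x : F) :
    ¬ IsSquare (x ^ 2 - 4 * a) ↔ ∃ z : A,
      z * FiniteField.frobeniusAlgHom F A z = algebraMap F A a ∧
      z + FiniteField.frobeniusAlgHom F A z = algebraMap F A x := by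
  have h2' : (2 : A) ≠ 0 := by
    rw [← map_ofNat (algebraMap F A) 2]
    exact (_root_.map_ne_zero _).mpr h2
  constructor
  · intro h
    obtain ⟨s, hs⟩ := IsAlgClosed.exists_eq_mul_self (algebraMap F A (x ^ 2 - 4 * a))
    have hφ : FiniteField.frobeniusAlgHom F A s = -s := by
      have h1 : FiniteField.frobeniusAlgHom F A s * FiniteField.frobeniusAlgHom F A s = s * s := by
        rw [← map_mul, ← hs, AlgHom.commutes]
      refine (mul_self_eq_mul_self_iff.mp h1).resolve_left fun h1 => ?_
      obtain ⟨t, rfl⟩ := exists_algebraMap_eq_of_pow_card (F := F) (A := A) (z := s)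
        (by simpa using h1)
      rw [← map_mul] at hs
      exact h ⟨t, (algebraMap F A).injective hs⟩
    have hz : FiniteField.frobeniusAlgHom F A ((algebraMap F A x + s) / 2)
        = (algebraMap F A x - s) / 2 := by
      rw [map_div₀, map_add, AlgHom.commutes, hφ, map_ofNat, sub_eq_add_neg]
    refine ⟨(algebraMap F A x + s) / 2, ?_, ?_⟩
    · rw [hz]
      simp only [map_sub, map_mul, map_pow, map_ofNat] at hs
      field_simp
      linear_combination hs
    · rw [hz]
      field_simp
      ring
  · rintro ⟨z, hz, hx⟩ ⟨s, hs⟩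
    have key : ∀ t : F, z ≠ algebraMap F A t := by
      rintro t rfl
      rw [AlgHom.commutes, ← map_mul] at hz
      exact ha ⟨t, ((algebraMap F A).injective hz).symm⟩
    have hs' := congrArg (algebraMap F A) hs
    simp only [map_sub, map_mul, map_pow, map_ofNat, ← hx, ← hz] at hs'
    have h1 : (z - FiniteField.frobeniusAlgHom F A z) * (z - FiniteField.frobeniusAlgHom F A z)
        = algebraMap F A s * algebraMap F A s := by linear_combination hs'
    rcases mul_self_eq_mul_self_iff.mp h1 with h | h
    · refine key ((x + s) / 2) ?_
      rw [map_div₀, map_add, map_ofNat, ← hx, ← h]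
      field_simp
      ring
    · refine key ((x - s) / 2) ?_
      rw [map_div₀, map_sub, map_ofNat, ← hx, ← neg_eq_iff_eq_neg.mpr h]
      field_simp
      ring

theorem pow_eq_and_two_pow_dvd {F A : Type*} [Field F] [Fintype F] [Field A] [Algebra F A]
    (h2 : (2 : F) ≠ 0) {a y : F} (ha0 : a ≠ 0) (hy : y ≠ 0) {k m r : ℕ}
    (hk : Fintype.card F = 2 * k + 1) (hak : a ^ k = -1) (hr : 2 ^ r ∣ 4 * (k * (k + 1)))
    {z : A} (hz : z * FiniteField.frobeniusAlgHom F A z = algebraMap F A a)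
    (hyz : algebraMap F A y ^ (2 * m) = z ^ (2 * m)) :
    y ^ (2 * m) = a ^ m ∧ 2 ^ r ∣ 2 * m := by
  have hneF : (-1 : F) ≠ 1 := fun h => h2 (by linear_combination -h)
  have hne : (-1 : A) ≠ 1 := fun h => hneF ((algebraMap F A).injective (by simpa using h))
  have ha0' : algebraMap F A a ≠ 0 := (_root_.map_ne_zero _).mpr ha0
  have hzq : z ^ (2 * (k + 1)) = algebraMap F A a := by
    rw [← hz, FiniteField.coe_frobeniusAlgHom, hk]
    ring
  have hv : (y ^ 2 / a) ^ k = -1 := by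
    have := FiniteField.pow_card_sub_one_eq_one y hy
    rw [hk, Nat.add_sub_cancel] at this
    rw [div_pow, ← pow_mul, this, hak]
    norm_num
  have hu : (z ^ 2 / algebraMap F A a) ^ (k + 1) = -1 := by
    rw [div_pow, ← pow_mul, hzq, pow_succ, ← map_pow, hak]
    simp [ha0']
  have huv : (z ^ 2 / algebraMap F A a) ^ m = algebraMap F A ((y ^ 2 / a) ^ m) := by
    rw [map_pow, map_div₀, map_pow, div_pow, div_pow, ← pow_mul, ← pow_mul, hyz]
  have hsq : (y ^ (2 * m)) * (y ^ (2 * m)) = a ^ m * a ^ m := by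
    apply (algebraMap F A).injective
    have h1 : FiniteField.frobeniusAlgHom F A z ^ (2 * m) = algebraMap F A y ^ (2 * m) := by
      rw [← map_pow, ← hyz, ← map_pow, AlgHom.commutes]
    simp only [map_mul, map_pow]
    nth_rewrite 1 [hyz]
    rw [← h1, ← mul_pow, hz]
    ring
  rcases mul_self_eq_mul_self_iff.mp hsq with h | h
  · refine ⟨h, ?_⟩
    have hv1 : (y ^ 2 / a) ^ m = 1 := by
      rw [div_pow, ← pow_mul, h, div_self (pow_ne_zero _ ha0)]
    rw [hv1, map_one] at huv
    rcases Nat.lt_or_ge r 2 with hr2 | hr2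
    · exact (pow_dvd_pow 2 (Nat.lt_succ_iff.mp hr2)).trans (by simp)
    · obtain ⟨s, rfl⟩ := Nat.exists_eq_add_of_le' hr2
      have hs : 2 ^ s ∣ k * (k + 1) := by
        rw [pow_add, mul_comm] at hr
        exact Nat.dvd_of_mul_dvd_mul_left (by norm_num) hr
      have hs' : 2 ^ s ∣ k ∨ 2 ^ s ∣ k + 1 := by
        rcases Nat.even_or_odd k with he | ho
        · exact .inl ((Nat.Coprime.pow_left _
            (Nat.coprime_two_left.mpr he.add_one)).dvd_of_dvd_mul_right hs)
        · exact .inr ((Nat.Coprime.pow_left _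
            (Nat.coprime_two_left.mpr ho)).dvd_of_dvd_mul_left hs)
      rw [show s + 2 = (s + 1) + 1 from rfl, pow_succ']
      refine mul_dvd_mul_left 2 (hs'.elim ?_ ?_)
      · exact two_pow_succ_dvd_of_pow_eq_neg_one hneF hv hv1
      · exact two_pow_succ_dvd_of_pow_eq_neg_one hne hu huv
  · exfalso
    have hv1 : (y ^ 2 / a) ^ m = -1 := by
      rw [div_pow, ← pow_mul, h, neg_div, div_self (pow_ne_zero _ ha0)]
    rw [hv1, map_neg, map_one] at huv
    have e1 := even_iff_even_of_pow_eq_neg_one hneF hv hv1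
    have e2 := even_iff_even_of_pow_eq_neg_one hne hu huv
    rw [← e1, Nat.even_add_one] at e2
    tauto

theorem exists_common_value {F A : Type*} [Field F] [Fintype F] [Field A] [Algebra F A]
    [IsAlgClosed A] {a : F} (ha0 : a ≠ 0) {k m r : ℕ}
    (hk : Fintype.card F = 2 * k + 1) (hak : a ^ k = -1) (hr : 2 ^ r ∣ 4 * (k * (k + 1)))
    (hr' : ¬ 2 ^ (r + 1) ∣ 4 * (k * (k + 1))) (hm : 2 ^ r ∣ 2 * m) :
    ∃ (y : F) (z : A), y ≠ 0 ∧ y ^ (2 * m) = a ^ m ∧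
      z * FiniteField.frobeniusAlgHom F A z = algebraMap F A a ∧
      z ^ (2 * m) = algebraMap F A a ^ m := by
  have ha0' : algebraMap F A a ≠ 0 := (_root_.map_ne_zero _).mpr ha0
  obtain ⟨t, ht⟩ := hr
  obtain ⟨c, hc⟩ := hm
  have htodd : Odd t := by
    rw [← Nat.not_even_iff_odd]
    rintro ⟨f, rfl⟩
    exact hr' ⟨f, by rw [ht]; ring⟩
  obtain ⟨j, rfl⟩ := htodd
  have htm : (2 * j + 1) * m = 2 * (k * (k + 1) * c) := by
    have : 2 * ((2 * j + 1) * m) = 2 * (2 * (k * (k + 1) * c)) := by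
      calc _ = (2 * j + 1) * (2 * m) := by ring
        _ = 2 ^ r * (2 * j + 1) * c := by rw [hc]; ring
        _ = _ := by rw [← ht]; ring
    omega
  have hatm : a ^ ((2 * j + 1) * m) = 1 := by
    rw [htm, show 2 * (k * (k + 1) * c) = k * (2 * ((k + 1) * c)) by ring, pow_mul, hak, pow_mul]
    simp
  obtain ⟨z, hz⟩ := IsAlgClosed.exists_pow_nat_eq (algebraMap F A a)
    (n := 2 * (k + 1)) (by positivity)
  have hφ : z * FiniteField.frobeniusAlgHom F A z = algebraMap F A a := by
    rw [← hz, FiniteField.coe_frobeniusAlgHom, hk]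
    ring
  refine ⟨a ^ (j + 1), z ^ (2 * j + 1) / algebraMap F A a ^ j, pow_ne_zero _ ha0, ?_, ?_, ?_⟩
  · rw [← pow_mul, show (j + 1) * (2 * m) = (2 * j + 1) * m + m by ring, pow_add, hatm, one_mul]
  · rw [map_div₀, map_pow, map_pow, AlgHom.commutes, div_mul_div_comm, ← mul_pow, hφ]
    field_simp
    ring
  · rw [div_pow, div_eq_iff (by positivity), ← pow_mul,
      show (2 * j + 1) * (2 * m) = 2 * ((2 * j + 1) * m) by ring, htm,
      show 2 * (2 * (k * (k + 1) * c)) = 2 * (k + 1) * (k * 2 * c) by ring, pow_mul, hz,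
      mul_assoc, pow_mul, ← map_pow, hak, ← pow_mul, ← pow_add,
      show m + j * (2 * m) = (2 * j + 1) * m by ring, ← map_pow, ← map_pow, hatm, pow_mul]
    simp

/-- For `a` a nonsquare, the hyperbolic and elliptic images of `D_n(·,a)` intersect
exactly in `{2 a^(n/2)}` when `2^r ∣ n`, and are disjoint otherwise. -/
theorem nonresidue_hyperbolic_elliptic_overlap {F : Type*} [Field F] [Fintype F]
    {q : ℕ} (hF : Fintype.card F = q) (hq : Odd q) (hq3 : 3 < q)
    (a : F) (ha : ¬ IsSquare a) (ha0 : a ≠ 0) (n : ℕ) (hn : Even n)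
    (r : ℕ) (hr : 2 ^ r ∣ q ^ 2 - 1 ∧ ¬ 2 ^ (r + 1) ∣ q ^ 2 - 1) :
    ((fun x : F => Polynomial.eval x (Polynomial.dickson 1 a n)) ''
        {x : F | x ^ 2 - 4 * a ≠ 0 ∧ IsSquare (x ^ 2 - 4 * a)}) ∩
      ((fun x : F => Polynomial.eval x (Polynomial.dickson 1 a n)) ''
        {x : F | ¬ IsSquare (x ^ 2 - 4 * a)}) =
      if 2 ^ r ∣ n then {2 * a ^ (n / 2)} else ∅ := by
  obtain ⟨k, rfl⟩ := hq
  obtain ⟨m, rfl⟩ := hn.two_dvd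
  have hchar : ringChar F ≠ 2 := fun h => ha (FiniteField.isSquare_of_char_two h a)
  have h2 : (2 : F) ≠ 0 := Ring.two_ne_zero hchar
  have hak : a ^ k = -1 := by
    have hk : Fintype.card F / 2 = k := by omega
    have h := FiniteField.pow_dichotomy hchar ha0
    rw [FiniteField.isSquare_iff hchar ha0] at ha
    exact hk ▸ h.resolve_left ha
  have hq2 : (2 * k + 1) ^ 2 - 1 = 4 * (k * (k + 1)) := by
    rw [Nat.sub_eq_iff_eq_add (Nat.one_le_pow _ _ (by omega))]
    ring
  rw [hq2] at hr
  have hval : ∀ y w : F, y * w = a → y ^ (2 * m) = a ^ m →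
      (dickson 1 a (2 * m)).eval (y + w) = 2 * a ^ m := by
    intro y w hyw hy
    have hw : w ^ (2 * m) = a ^ m := by
      apply mul_left_cancel₀ (pow_ne_zero m ha0)
      rw [← hy, ← mul_pow, hyw, hy]
      ring
    rw [dickson_one_eval_add hyw, hy, hw, two_mul]
  let A := AlgebraicClosure F
  let φ := FiniteField.frobeniusAlgHom F A
  have heval : ∀ (z : A) (x : F), z * φ z = algebraMap F A a → z + φ z = algebraMap F A x →
      algebraMap F A ((dickson 1 a (2 * m)).eval x) = z ^ (2 * m) + φ z ^ (2 * m) := by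
    intro z x hz hx
    rw [← dickson_one_eval_add hz, hx, ← map_dickson, eval_map_algebraMap, aeval_algebraMap_apply,
      coe_aeval_eq_eval]
  have hforward : ∀ d, d ∈ ((fun x : F => (dickson 1 a (2 * m)).eval x) ''
        {x : F | x ^ 2 - 4 * a ≠ 0 ∧ IsSquare (x ^ 2 - 4 * a)}) ∩
      ((fun x : F => (dickson 1 a (2 * m)).eval x) '' {x : F | ¬ IsSquare (x ^ 2 - 4 * a)}) →
      d = 2 * a ^ m ∧ 2 ^ r ∣ 2 * m := by
    rintro d ⟨⟨x, hx, rfl⟩, ⟨x', hx', he⟩⟩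
    obtain ⟨y, w, hyw, rfl⟩ := (sq_sub_four_mul_isSquare_iff h2 ha x).mp hx
    obtain ⟨z, hz, hzx⟩ := (not_isSquare_sq_sub_four_mul_iff (A := A) h2 ha x').mp hx'
    have hy : y ≠ 0 := by
      rintro rfl
      exact ha0 (by rw [← hyw, zero_mul])
    have hsuff : y ^ (2 * m) = a ^ m ∧ 2 ^ r ∣ 2 * m := by
      have h1 := heval z x' hz hzx
      have h3 : algebraMap F A y ^ (2 * m) * algebraMap F A w ^ (2 * m) =
          z ^ (2 * m) * φ z ^ (2 * m) := by
        rw [← mul_pow, ← mul_pow, hz, ← map_mul, hyw]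
      dsimp only at he
      rw [he, dickson_one_eval_add hyw, map_add, map_pow, map_pow] at h1
      have h4 : (algebraMap F A y ^ (2 * m) - z ^ (2 * m)) *
          (algebraMap F A y ^ (2 * m) - φ z ^ (2 * m)) = 0 := by
        linear_combination algebraMap F A y ^ (2 * m) * h1 - h3
      rcases mul_eq_zero.mp h4 with h | h
      · exact pow_eq_and_two_pow_dvd h2 ha0 hy hF hak hr.1 hz (sub_eq_zero.mp h)
      · refine pow_eq_and_two_pow_dvd h2 ha0 hy hF hak hr.1 ?_ (sub_eq_zero.mp h)
        rw [← map_mul, hz, AlgHom.commutes]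
    exact ⟨hval y w hyw hsuff.1, hsuff.2⟩
  rw [Nat.mul_div_cancel_left m two_pos]
  split_ifs with hdvd
  · refine Set.Subset.antisymm (fun d hd => (hforward d hd).1) ?_
    rintro _ rfl
    obtain ⟨y, z, hy, hyn, hz, hzn⟩ := exists_common_value (A := A) ha0 hF hak hr.1 hr.2 hdvd
    have hyw : y * (a / y) = a := mul_div_cancel₀ a hy
    refine ⟨⟨y + a / y, (sq_sub_four_mul_isSquare_iff h2 ha _).mpr ⟨y, _, hyw, rfl⟩,
      hval _ _ hyw hyn⟩, ?_⟩
    have hz0 : z ≠ 0 := by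
      rintro rfl
      rw [zero_mul] at hz
      exact ha0 ((map_eq_zero _).mp hz.symm)
    have hφφ : φ (φ z) = z := by
      have h : φ z * φ (φ z) = φ z * z := by
        rw [← map_mul, hz, AlgHom.commutes, ← hz, mul_comm]
      exact mul_left_cancel₀ ((_root_.map_ne_zero φ).mpr hz0) h
    obtain ⟨x, hx⟩ := exists_algebraMap_eq_of_pow_card (F := F) (A := A) (z := z + φ z) (by
      change φ (z + φ z) = _
      rw [map_add, hφφ, add_comm])
    refine ⟨x, (not_isSquare_sq_sub_four_mul_iff (A := A) h2 ha x).mpr ⟨z, hz, hx.symm⟩, ?_⟩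
    apply (algebraMap F A).injective
    dsimp only
    rw [heval z x hz hx.symm, ← map_pow, hzn, map_pow, AlgHom.commutes, map_mul, map_pow, map_ofNat,
      two_mul]
  · exact Set.eq_empty_of_forall_notMem fun d hd => hdvd (hforward d hd).2
end
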